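/- Let 𝒳 and 𝒴 be boundedly compact pmm spaces. The quantity a(ε, r; 𝒳, 𝒴) is non-increasing in ε (for fixed r). Moreover, if a(ε, r₀; 𝒳, 𝒴) ≤ ε/2, then r ↦ a(ε, r; 𝒳, 𝒴) is non-decreasing on the interval [ε, r₀]. -/

import Mathlib

open MeasureTheory Topology Filter

noncomputable section

/-- Prokhorov distance between finite Borel measures on a metric space. -/
def prokhorovDist {Z : Type*} [MetricSpace Z] [MeasurableSpace Z]
    (μ ν : Measure Z) : ℝ :=
  sInf {ε : ℝ | 0 < ε ∧ ∀ A : Set Z, IsClosed A →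
    μ A ≤ ν (Metric.cthickening ε A) + ENNReal.ofReal ε ∧
    ν A ≤ μ (Metric.cthickening ε A) + ENNReal.ofReal ε}

/-- A pointed measured metric space: a metric space with a distinguished point and a Borel
measure. -/
structure PMM : Type 1 where
  carrier : Type
  metric : MetricSpace carrier
  basepoint : carrier
  meas : @Measure carrier
    (@borel carrier metric.toPseudoMetricSpace.toUniformSpace.toTopologicalSpace)

attribute [instance] PMM.metric

instance PMM.instMeasurableSpace (𝒳 : PMM) : MeasurableSpace 𝒳.carrier := borel 𝒳.carrier

instance PMM.instBorelSpace (𝒳 : PMM) : BorelSpace 𝒳.carrier := ⟨rfl⟩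

/-- A pmm space is boundedly compact if every closed ball is compact and has finite measure. -/
def PMM.BoundedlyCompact (𝒳 : PMM) : Prop :=
  (∀ (x : 𝒳.carrier) (r : ℝ), IsCompact (Metric.closedBall x r)) ∧
  (∀ (x : 𝒳.carrier) (r : ℝ), 𝒳.meas (Metric.closedBall x r) ≠ ⊤)

/-- A pmm space is compact if its carrier is compact and its measure is finite. -/
def PMM.IsCompactPMM (𝒳 : PMM) : Prop :=
  CompactSpace 𝒳.carrier ∧ 𝒳.meas Set.univ ≠ ⊤

/-- A pair of maps of two pmm spaces into a common metric space. -/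
structure GHPEmbedding (𝒳 𝒴 : PMM) : Type 1 where
  Z : Type
  mZ : MetricSpace Z
  f : 𝒳.carrier → Z
  g : 𝒴.carrier → Z

attribute [instance] GHPEmbedding.mZ

/-- Both maps of a `GHPEmbedding` are isometric embeddings. -/
def GHPEmbedding.IsIsometric {𝒳 𝒴 : PMM} (e : GHPEmbedding 𝒳 𝒴) : Prop :=
  Isometry e.f ∧ Isometry e.g

/-- The quantity `max(d(f o_X, g o_Y), dH(f(X), g(Y)), dP(f_*μ_X, g_*μ_Y))` associated to a
pair of embeddings into a common space. -/
def GHPEmbedding.value {𝒳 𝒴 : PMM} (e : GHPEmbedding 𝒳 𝒴) : ℝ :=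
  letI : MeasurableSpace e.Z := borel e.Z
  max (dist (e.f 𝒳.basepoint) (e.g 𝒴.basepoint))
    (max (Metric.hausdorffDist (Set.range e.f) (Set.range e.g))
      (prokhorovDist (𝒳.meas.map e.f) (𝒴.meas.map e.g)))

/-- The Gromov-Hausdorff-Prokhorov distance of compact pmm spaces. -/
def cGHP (𝒳 𝒴 : PMM) : ℝ :=
  sInf {x : ℝ | ∃ e : GHPEmbedding 𝒳 𝒴, e.IsIsometric ∧ x = e.value}

/-- A pmm-subspace of a pmm space `𝒳`: a subset containing the basepoint together with a
measure `≤ 𝒳.meas` supported on the subset. -/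
structure SubPMM (𝒳 : PMM) where
  set : Set 𝒳.carrier
  root_mem : 𝒳.basepoint ∈ set
  meas : Measure 𝒳.carrier
  meas_le : meas ≤ 𝒳.meas
  supported : meas setᶜ = 0

/-- The pmm space associated to a pmm-subspace. -/
def SubPMM.toPMM {𝒳 : PMM} (S : SubPMM 𝒳) : PMM where
  carrier := ↥S.set
  metric := inferInstance
  basepoint := ⟨𝒳.basepoint, S.root_mem⟩
  meas := @Measure.comap ↥S.set 𝒳.carrier (borel ↥S.set) inferInstance Subtype.val S.meas

/-- The pmm-subspace ordering: inclusion of sets and inequality of measures. -/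
instance {𝒳 : PMM} : LE (SubPMM 𝒳) :=
  ⟨fun S T => S.set ⊆ T.set ∧ S.meas ≤ T.meas⟩

/-- Compactness of a pmm-subspace. -/
def SubPMM.IsCompactSub {𝒳 : PMM} (S : SubPMM 𝒳) : Prop :=
  IsCompact S.set ∧ S.meas Set.univ ≠ ⊤

/-- The closed ball of radius `r` around the basepoint, as a pmm-subspace (for `r ≥ 0` the
underlying set is exactly the closed ball; the basepoint is inserted so that the definition
makes sense for all `r`). -/
def PMM.ballSub (𝒳 : PMM) (r : ℝ) : SubPMM 𝒳 where
  set := insert 𝒳.basepoint (Metric.closedBall 𝒳.basepoint r)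
  root_mem := Set.mem_insert _ _
  meas := 𝒳.meas.restrict (insert 𝒳.basepoint (Metric.closedBall 𝒳.basepoint r))
  meas_le := Measure.restrict_le_self
  supported := by
    rw [Measure.restrict_apply ((measurableSet_closedBall.insert 𝒳.basepoint).compl),
      Set.compl_inter_self]
    simp

/-- The quantity `a(ε, r; 𝒳, 𝒴)`. -/
def aFun (ε r : ℝ) (𝒳 𝒴 : PMM) : ℝ :=
  sInf {x : ℝ | ∃ Y' : SubPMM 𝒴, Y'.IsCompactSub ∧ 𝒴.ballSub (r - ε) ≤ Y' ∧
    x = cGHP ((𝒳.ballSub r).toPMM) Y'.toPMM}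

/-- The quantity `a_ε(𝒳, 𝒴) = a(ε, 1/ε; 𝒳, 𝒴)`. -/
def aEps (ε : ℝ) (𝒳 𝒴 : PMM) : ℝ := aFun ε (1 / ε) 𝒳 𝒴

/-- The Gromov-Hausdorff-Prokhorov distance of boundedly compact pmm spaces
(with `inf ∅ = 1`). -/
def GHP (𝒳 𝒴 : PMM) : ℝ :=
  sInf (insert 1 {ε : ℝ | ε ∈ Set.Ioc (0 : ℝ) 1 ∧ max (aEps ε 𝒳 𝒴) (aEps ε 𝒴 𝒳) < ε / 2})

/-- Two pmm spaces are GHP-isometric if there is a root-preserving measure-preserving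
surjective isometry between them. -/
def GHPIsometric (𝒳 𝒴 : PMM) : Prop :=
  ∃ ρ : 𝒳.carrier → 𝒴.carrier, Isometry ρ ∧ Function.Surjective ρ ∧
    ρ 𝒳.basepoint = 𝒴.basepoint ∧ 𝒳.meas.map ρ = 𝒴.meas

/-- `r` is a continuity radius of a pmm space. -/
def PMM.ContinuityRadius (𝒳 : PMM) (r : ℝ) : Prop :=
  0 < r ∧ Metric.closedBall 𝒳.basepoint r = closure (Metric.ball 𝒳.basepoint r) ∧
    𝒳.meas (Metric.closedBall 𝒳.basepoint r \ Metric.ball 𝒳.basepoint r) = 0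

lemma finite_core {F : Type*} [Fintype F] [DecidableEq F] (N : Finset F → Finset F)
    (R : F → F → Prop) (hR : ∀ i j, R i j → R j i)
    (hN : ∀ S j, j ∈ N S ↔ ∃ i ∈ S, R i j)
    (m a b : F → ℝ) (hm : ∀ i, 0 ≤ m i) (hb : ∀ i, 0 ≤ b i) (hab : a ≤ b) (δ : ℝ)
    (h1 : ∀ S, ∑ i ∈ S, m i ≤ ∑ i ∈ N S, b i + δ)
    (h2 : ∀ S, ∑ i ∈ S, a i ≤ ∑ i ∈ N S, m i + δ) :
    ∃ x : F → ℝ, a ≤ x ∧ x ≤ b ∧ (∀ S, ∑ i ∈ S, m i ≤ ∑ i ∈ N S, x i + δ) ∧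
      (∀ S, ∑ i ∈ S, x i ≤ ∑ i ∈ N S, m i + δ) := by
  set C : Set (F → ℝ) := Set.Icc a b ∩ ⋂ S : Finset F, {x | ∑ i ∈ S, x i ≤ ∑ i ∈ N S, m i + δ}
    with hC
  have hCc : IsCompact C := by
    apply isCompact_Icc.inter_right
    apply isClosed_iInter
    intro S
    exact isClosed_le (by fun_prop) (by fun_prop)
  have haC : a ∈ C := ⟨⟨le_rfl, hab⟩, by simpa using h2⟩
  obtain ⟨x, hxC, hmax⟩ := hCc.exists_isMaxOn ⟨a, haC⟩
    (f := fun x : F → ℝ => ∑ i, x i) (by fun_prop)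
  have hxS : ∀ S, ∑ i ∈ S, x i ≤ ∑ i ∈ N S, m i + δ := by simpa using hxC.2
  refine ⟨x, hxC.1.1, hxC.1.2, ?_, hxS⟩
  have hNu : ∀ A B, N (A ∪ B) = N A ∪ N B := by
    intro A B; ext j; simp only [hN, Finset.mem_union]
    constructor
    · rintro ⟨i, h | h, hr⟩
      · exact Or.inl ⟨i, h, hr⟩
      · exact Or.inr ⟨i, h, hr⟩
    · rintro (⟨i, h, hr⟩ | ⟨i, h, hr⟩)
      · exact ⟨i, Or.inl h, hr⟩
      · exact ⟨i, Or.inr h, hr⟩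
  have hNi : ∀ A B, N (A ∩ B) ⊆ N A ∩ N B := by
    intro A B j; simp only [hN, Finset.mem_inter]
    rintro ⟨i, ⟨h, h'⟩, hr⟩
    exact ⟨⟨i, h, hr⟩, ⟨i, h', hr⟩⟩
  have tight_union : ∀ A B, ∑ i ∈ A, x i = ∑ i ∈ N A, m i + δ →
      ∑ i ∈ B, x i = ∑ i ∈ N B, m i + δ →
      ∑ i ∈ A ∪ B, x i = ∑ i ∈ N (A ∪ B), m i + δ := by
    intro A B hA hB
    apply le_antisymm (hxS _)
    have e1 := Finset.sum_union_inter (s₁ := A) (s₂ := B) (f := x)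
    have e2 := Finset.sum_union_inter (s₁ := N A) (s₂ := N B) (f := m)
    have e3 := hxS (A ∩ B)
    have e4 : ∑ i ∈ N (A ∩ B), m i ≤ ∑ i ∈ N A ∩ N B, m i :=
      Finset.sum_le_sum_of_subset_of_nonneg (hNi A B) (fun i _ _ => hm i)
    rw [hNu]
    linarith
  have htight : ∀ j, x j < b j → ∃ S, j ∈ S ∧ ∑ i ∈ S, x i = ∑ i ∈ N S, m i + δ := by
    intro j hj
    by_contra! hcon
    have hlt : ∀ S, j ∈ S → ∑ i ∈ S, x i < ∑ i ∈ N S, m i + δ :=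
      fun S hS => lt_of_le_of_ne (hxS S) (hcon S hS)
    have : ∃ c > 0, c ≤ b j - x j ∧ ∀ S ∈ (Finset.univ : Finset (Finset F)), j ∈ S →
        c ≤ ∑ i ∈ N S, m i + δ - ∑ i ∈ S, x i := by
      have hne : (Finset.univ.filter (fun S : Finset F => j ∈ S)).Nonempty :=
        ⟨{j}, by simp⟩
      obtain ⟨S0, hS0, hmin⟩ := Finset.exists_min_image _
        (fun S => ∑ i ∈ N S, m i + δ - ∑ i ∈ S, x i) hne
      refine ⟨min (b j - x j) (∑ i ∈ N S0, m i + δ - ∑ i ∈ S0, x i), ?_, min_le_left _ _, ?_⟩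
      · apply lt_min (by linarith)
        have := hlt S0 (by simpa using hS0)
        linarith
      · intro S _ hS
        exact (min_le_right _ _).trans (hmin S (by simpa using hS))
    obtain ⟨c, hc, hcb, hcS⟩ := this
    set y : F → ℝ := fun i => x i + if i = j then c else 0 with hy
    have hysum : ∀ S : Finset F, ∑ i ∈ S, y i = ∑ i ∈ S, x i + if j ∈ S then c else 0 := by
      intro S
      simp [hy, Finset.sum_add_distrib]
    have hyC : y ∈ C := by
      refine ⟨⟨?_, ?_⟩, ?_⟩
      · intro i
        have := hxC.1.1 i
        simp only [hy]; split_ifs <;> linarith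
      · intro i
        have := hxC.1.2 i
        simp only [hy]; split_ifs with h
        · subst h; linarith
        · linarith
      · simp only [Set.mem_iInter, Set.mem_ofPred_eq]
        intro S
        rw [hysum]
        split_ifs with h
        · have := hcS S (Finset.mem_univ _) h; linarith
        · have := hxS S; linarith
    have := hmax hyC
    simp only [Set.mem_ofPred_eq] at this
    rw [hysum] at this
    simp at this
    linarith
  by_cases hex : ∃ S, ∑ i ∈ S, x i = ∑ i ∈ N S, m i + δ
  · have hne : (Finset.univ.filter
        (fun S : Finset F => ∑ i ∈ S, x i = ∑ i ∈ N S, m i + δ)).Nonempty := by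
      obtain ⟨S, hS⟩ := hex; exact ⟨S, by simpa using hS⟩
    obtain ⟨T, hT, hTmax⟩ := Finset.exists_max_image _ Finset.card hne
    have hTt : ∑ i ∈ T, x i = ∑ i ∈ N T, m i + δ := by simpa using hT
    have hTall : ∀ S, ∑ i ∈ S, x i = ∑ i ∈ N S, m i + δ → S ⊆ T := by
      intro S hS
      have h := hTmax (S ∪ T) (by simpa using tight_union S T hS hTt)
      have : T = S ∪ T := Finset.eq_of_subset_of_card_le Finset.subset_union_right h
      rw [this]; exact Finset.subset_union_left
    have hoff : ∀ j, j ∉ T → x j = b j := by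
      intro j hj
      by_contra hne
      obtain ⟨S, hjS, hS⟩ := htight j (lt_of_le_of_ne (hxC.1.2 j) hne)
      exact hj (hTall S hS hjS)
    intro A
    have s1 := Finset.sum_inter_add_sum_sdiff (N A) T x
    have s2 := Finset.sum_inter_add_sum_sdiff T (N A) x
    have s3 := hxS (T \ N A)
    have s4 := h1 (A \ N T)
    have s5 : ∑ i ∈ N A \ T, x i = ∑ i ∈ N A \ T, b i :=
      Finset.sum_congr rfl (fun j hj => hoff j (Finset.mem_sdiff.1 hj).2)
    have s6 := Finset.sum_inter_add_sum_sdiff A (N T) m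
    have hb' : ∑ i ∈ N (A \ N T), b i ≤ ∑ i ∈ N A \ T, x i := by
      rw [s5]
      apply Finset.sum_le_sum_of_subset_of_nonneg _ (fun i _ _ => hb i)
      intro i
      simp only [hN, Finset.mem_sdiff]
      rintro ⟨j, ⟨hjA, hjT⟩, hr⟩
      exact ⟨⟨j, hjA, hr⟩, fun hiT => hjT ⟨i, hiT, hR _ _ hr⟩⟩
    have s7 : ∑ i ∈ A ∩ N T, m i + ∑ i ∈ N (T \ N A), m i ≤ ∑ i ∈ N T, m i := by
      rw [← Finset.sum_union]
      · apply Finset.sum_le_sum_of_subset_of_nonneg _ (fun i _ _ => hm i)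
        intro i
        simp only [Finset.mem_union, Finset.mem_inter, hN, Finset.mem_sdiff]
        rintro (h | ⟨j, ⟨h, _⟩, hr⟩)
        · exact h.2
        · exact ⟨j, h, hr⟩
      · rw [Finset.disjoint_left]
        intro i
        simp only [Finset.mem_inter, hN, Finset.mem_sdiff]
        rintro ⟨hA, _⟩ ⟨j, ⟨_, hj⟩, hr⟩
        exact hj ⟨i, hA, hR _ _ hr⟩
    rw [Finset.inter_comm (N A) T] at s1
    linarith
  · have hxb : x = b := by
      funext j
      by_contra hne
      obtain ⟨S, _, hS⟩ := htight j (lt_of_le_of_ne (hxC.1.2 j) hne)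
      exact hex ⟨S, hS⟩
    rw [hxb]; exact h1

lemma cut_null {Z : Type*} [MeasurableSpace Z] (ν : Measure Z) (C : Set Z) (h : ν Cᶜ = 0)
    (B : Set Z) : ν B = ν (B ∩ C) := by
  apply le_antisymm _ (measure_mono Set.inter_subset_left)
  calc ν B ≤ ν ((B ∩ C) ∪ Cᶜ) := measure_mono (fun z hz => by
        by_cases hc : z ∈ C
        · exact Or.inl ⟨hz, hc⟩
        · exact Or.inr hc)
    _ ≤ ν (B ∩ C) + ν Cᶜ := measure_union_le _ _
    _ = ν (B ∩ C) := by rw [h, add_zero]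

lemma real_le_of {Z : Type*} [MeasurableSpace Z] (m n : Measure Z) [IsFiniteMeasure m]
    [IsFiniteMeasure n] (A B : Set Z) (δ : ℝ) (hδ : 0 ≤ δ) :
    m A ≤ n B + ENNReal.ofReal δ ↔ m.real A ≤ n.real B + δ := by
  have h1 : m A = ENNReal.ofReal (m.real A) := by simp
  have h2 : n B = ENNReal.ofReal (n.real B) := by simp
  rw [h1, h2, ← ENNReal.ofReal_add (by positivity) hδ,
    ENNReal.ofReal_le_ofReal_iff (by positivity)]

lemma exists_discretization {Z : Type*} [MetricSpace Z] [MeasurableSpace Z] [BorelSpace Z]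
    (K : Set Z) (hK : IsCompact K) (hne : K.Nonempty) (η : ℝ) (hη : 0 < η) :
    ∃ φ : SimpleFunc Z Z, ∀ z ∈ K, dist (φ z) z < η := by
  obtain ⟨t, _, htf, hcov⟩ := hK.finite_cover_balls hη
  obtain ⟨z0, _⟩ := hne
  have : ∃ (N : ℕ) (e : ℕ → Z), ∀ z ∈ t, ∃ k ≤ N, e k = z := by
    classical
    let T := htf.toFinset
    refine ⟨T.card, fun k => if h : k < T.card then (T.equivFin.symm ⟨k, h⟩ : Z) else z0, ?_⟩
    intro z hz
    have hzT : z ∈ T := by simpa [T] using hz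
    refine ⟨T.equivFin ⟨z, hzT⟩, (T.equivFin ⟨z, hzT⟩).2.le, ?_⟩
    simp
  obtain ⟨N, e, he⟩ := this
  refine ⟨SimpleFunc.nearestPt e N, fun z hz => ?_⟩
  have := hcov hz
  simp only [Set.mem_iUnion, Metric.mem_ball, exists_prop] at this
  obtain ⟨p, hp, hd⟩ := this
  obtain ⟨k, hk, rfl⟩ := he p hp
  have := SimpleFunc.edist_nearestPt_le e z hk
  rw [edist_dist, edist_dist, ENNReal.ofReal_le_ofReal_iff dist_nonneg] at this
  rw [dist_comm] at hd
  linarith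

lemma core_Z {Z : Type*} [MetricSpace Z] [MeasurableSpace Z] [BorelSpace Z]
    (m n : Measure Z) [IsFiniteMeasure m] [IsFiniteMeasure n] (K L K' L₁ : Set Z)
    (hK : IsCompact K) (hL : IsCompact L) (hKne : K.Nonempty)
    (hL₁ : IsClosed L₁)
    (hK'K : K' ⊆ K) (hL₁L : L₁ ⊆ L) (hm : m Kᶜ = 0) (hn : n Lᶜ = 0) (δ : ℝ) (hδ : 0 < δ)
    (hP : ∀ A : Set Z, IsClosed A →
      m A ≤ n (Metric.cthickening δ A) + ENNReal.ofReal δ ∧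
      n A ≤ m (Metric.cthickening δ A) + ENNReal.ofReal δ)
    (hLK : ∀ z ∈ K, z ∈ Metric.cthickening δ L₁ → z ∈ K')
    (hLK' : L₁ ⊆ Metric.cthickening δ K') (η : ℝ) (hη : 0 < η) :
    ∃ n' : Measure Z, n' ≤ n ∧ n.restrict L₁ ≤ n' ∧ n' (L ∩ Metric.cthickening δ K')ᶜ = 0 ∧
      ∀ A : Set Z, IsClosed A →
      (m.restrict K') A ≤ n' (Metric.cthickening (δ + 5 * η) A) + ENNReal.ofReal δ ∧
      n' A ≤ (m.restrict K') (Metric.cthickening (δ + 5 * η) A) + ENNReal.ofReal δ := by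
  classical
  obtain ⟨φ, hφ⟩ := exists_discretization (K ∪ L) (hK.union hL) (hKne.mono Set.subset_union_left)
    η hη
  set L' := L ∩ Metric.cthickening δ K' with hL'
  have hL'm : MeasurableSet L' := (hL.isClosed.inter Metric.isClosed_cthickening).measurableSet
  have hL₁L' : L₁ ⊆ L' := fun z hz => ⟨hL₁L hz, hLK' hz⟩
  let F := ↥φ.range
  let ψ : Z → F := fun z => ⟨φ z, SimpleFunc.mem_range_self φ z⟩
  have hψ : ∀ S : Set F, MeasurableSet (ψ ⁻¹' S) := by
    intro S
    have : ψ ⁻¹' S = φ ⁻¹' (Subtype.val '' S) := by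
      ext z; simp [ψ, F]
    rw [this]; exact φ.measurableSet_preimage _
  let R : F → F → Prop := fun i j => dist (i : Z) j ≤ δ + 3 * η
  let N : Finset F → Finset F := fun S => Finset.univ.filter (fun j => ∃ i ∈ S, R i j)
  have hN : ∀ S j, j ∈ N S ↔ ∃ i ∈ S, R i j := by intro S j; simp [N]
  set n1 := n.restrict L₁ with hn1
  set n2 := n.restrict L' with hn2
  set n3 := n.restrict (L' \ L₁) with hn3
  set m' := m.restrict K' with hm'
  have hn12 : n2 = n1 + n3 := by
    rw [hn2, hn1, hn3, ← Measure.restrict_union Set.disjoint_sdiff_right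
      (hL'm.diff hL₁.measurableSet), Set.union_sdiff_cancel hL₁L']
  have hclose : ∀ (S : Finset F) (C : Set Z), C ⊆ K ∪ L → ∀ z ∈ K ∪ L,
      z ∈ Metric.cthickening δ (ψ ⁻¹' S ∩ C) → z ∈ ψ ⁻¹' (N S) := by
    intro S C hC z hz hzt
    have hz2 : z ∈ Metric.thickening (δ + η) (ψ ⁻¹' S ∩ C) :=
      Metric.cthickening_subset_thickening' (by linarith) (by linarith) _ hzt
    obtain ⟨p, ⟨hpS, hpC⟩, hd⟩ := Metric.mem_thickening_iff.1 hz2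
    simp only [Set.mem_preimage, Finset.mem_coe, hN]
    refine ⟨ψ p, hpS, ?_⟩
    have a1 := hφ z hz
    have a2 := hφ p (hC hpC)
    have a3 := dist_triangle4 (φ p) p z (φ z)
    rw [dist_comm p z, dist_comm z (φ z)] at a3
    change dist (φ p) (φ z) ≤ _
    linarith
  have sum_eq : ∀ (ν : Measure Z) [IsFiniteMeasure ν] (S : Finset F),
      ∑ j ∈ S, ν.real (ψ ⁻¹' {j}) = ν.real (ψ ⁻¹' S) := by
    intro ν _ S
    exact sum_measureReal_preimage_singleton S (fun y _ => hψ _)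
  have h1 : ∀ S : Finset F, ∑ i ∈ S, m'.real (ψ ⁻¹' {i}) ≤
      ∑ i ∈ N S, n2.real (ψ ⁻¹' {i}) + δ := by
    intro S
    rw [sum_eq, sum_eq, ← real_le_of _ _ _ _ _ hδ.le]
    rw [hm', hn2, Measure.restrict_apply (hψ _), Measure.restrict_apply (hψ _)]
    refine (measure_mono subset_closure).trans (((hP _ isClosed_closure).1).trans ?_)
    gcongr ?_ + _
    rw [Metric.cthickening_closure]
    rw [cut_null n L hn (Metric.cthickening δ (ψ ⁻¹' S ∩ K'))]
    apply measure_mono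
    rintro z ⟨hz, hzL⟩
    exact ⟨hclose S K' (hK'K.trans Set.subset_union_left) z (Or.inr hzL) hz, hzL,
      Metric.cthickening_subset_of_subset _ Set.inter_subset_right hz⟩
  have h2 : ∀ S : Finset F, ∑ i ∈ S, n1.real (ψ ⁻¹' {i}) ≤
      ∑ i ∈ N S, m'.real (ψ ⁻¹' {i}) + δ := by
    intro S
    rw [sum_eq, sum_eq, ← real_le_of _ _ _ _ _ hδ.le]
    rw [hm', hn1, Measure.restrict_apply (hψ _), Measure.restrict_apply (hψ _)]
    refine (measure_mono subset_closure).trans (((hP _ isClosed_closure).2).trans ?_)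
    gcongr ?_ + _
    rw [Metric.cthickening_closure]
    rw [cut_null m K hm (Metric.cthickening δ (ψ ⁻¹' S ∩ L₁))]
    apply measure_mono
    rintro z ⟨hz, hzK⟩
    exact ⟨hclose S L₁ (hL₁L.trans Set.subset_union_right) z (Or.inl hzK) hz,
      hLK z hzK (Metric.cthickening_subset_of_subset _ Set.inter_subset_right hz)⟩
  have h12 : ∀ B, n2.real B = n1.real B + n3.real B := by
    intro B; rw [hn12, measureReal_add_apply]
  obtain ⟨x, hax, hxb, hx1, hx2⟩ := finite_core N R (fun i j h => by
      simp only [R] at h ⊢; rwa [dist_comm]) hN (fun i => m'.real (ψ ⁻¹' {i}))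
    (fun i => n1.real (ψ ⁻¹' {i})) (fun i => n2.real (ψ ⁻¹' {i})) (fun i => measureReal_nonneg)
    (fun i => measureReal_nonneg) (fun i => by
      simp only [h12]
      linarith [measureReal_nonneg (μ := n3) (s := ψ ⁻¹' {i})]) δ h1 h2
  have hc : ∀ j : F, ∃ c : ℝ, 0 ≤ c ∧ c ≤ 1 ∧ x j = n1.real (ψ ⁻¹' {j}) + c * n3.real (ψ ⁻¹' {j}) := by
    intro j
    have b1 := hax j
    have b2 := hxb j
    simp only [h12] at b1 b2
    rcases (measureReal_nonneg (μ := n3) (s := ψ ⁻¹' {j})).eq_or_lt with h0 | h0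
    · exact ⟨0, le_rfl, zero_le_one, by linarith⟩
    · refine ⟨(x j - n1.real (ψ ⁻¹' {j})) / n3.real (ψ ⁻¹' {j}), div_nonneg (by linarith) h0.le,
        (div_le_one h0).2 (by linarith), ?_⟩
      field_simp
      ring
  choose c hc0 hc1 hcx using hc
  set n' : Measure Z := n1 + n3.withDensity (fun z => ENNReal.ofReal (c (ψ z))) with hn'
  have hwd : n3.withDensity (fun z => ENNReal.ofReal (c (ψ z))) ≤ n3 := by
    conv_rhs => rw [← withDensity_one (μ := n3)]
    apply withDensity_mono
    filter_upwards with z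
    simpa using hc1 (ψ z)
  have hn'2 : n' ≤ n2 := by rw [hn12]; exact add_le_add le_rfl hwd
  have hn'n : n' ≤ n := hn'2.trans Measure.restrict_le_self
  have : IsFiniteMeasure n' := isFiniteMeasure_of_le n hn'n
  have hn'x : ∀ S : Finset F, n'.real (ψ ⁻¹' S) = ∑ j ∈ S, x j := by
    intro S
    rw [← sum_eq]
    refine Finset.sum_congr rfl fun j _ => ?_
    rw [hcx]
    have : IsFiniteMeasure (n3.withDensity (fun z => ENNReal.ofReal (c (ψ z)))) :=
      isFiniteMeasure_of_le n3 hwd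
    rw [hn', measureReal_add_apply]
    congr 1
    rw [Measure.real, withDensity_apply _ (hψ _)]
    rw [setLIntegral_congr_fun (g := fun _ => ENNReal.ofReal (c j)) (hψ _)
      (fun z hz => by simp only [Set.mem_preimage, Set.mem_singleton_iff] at hz; simp [hz])]
    simp [Measure.real, ENNReal.toReal_ofReal (hc0 j)]
  have hn'0 : n' L'ᶜ = 0 := by
    have := hn'2 L'ᶜ
    rw [hn2, Measure.restrict_apply hL'm.compl] at this
    simpa using this
  refine ⟨n', hn'n, Measure.le_add_right le_rfl, hn'0, ?_⟩
  have fin : ∀ (A : Set Z), ∀ z ∈ K ∪ L,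
      z ∈ ψ ⁻¹' (N (Finset.univ.filter (fun i => ∃ a ∈ A ∩ (K ∪ L), ψ a = i))) →
      z ∈ Metric.cthickening (δ + 5 * η) A := by
    intro A z hz hzN
    simp only [Set.mem_preimage, Finset.mem_coe, hN, Finset.mem_filter, Finset.mem_univ,
      true_and] at hzN
    obtain ⟨i, ⟨a, ⟨haA, haKL⟩, rfl⟩, hr⟩ := hzN
    apply Metric.mem_cthickening_of_dist_le z a _ _ haA
    have a1 := hφ z hz
    have a2 := hφ a haKL
    have a3 := dist_triangle4 z (φ z) (φ a) a
    change dist (φ a) (φ z) ≤ _ at hr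
    rw [dist_comm z (φ z), dist_comm (φ z) (φ a)] at a3
    linarith
  have hm'0 : m' Kᶜ = 0 := le_antisymm ((Measure.restrict_le_self _).trans hm.le) bot_le
  have hmKL : m' (K ∪ L)ᶜ = 0 :=
    measure_mono_null (Set.compl_subset_compl.2 Set.subset_union_left) hm'0
  have hnKL : n' (K ∪ L)ᶜ = 0 :=
    measure_mono_null (Set.compl_subset_compl.2 (fun z hz => Or.inr hz.1)) hn'0
  have cut : ∀ (ν : Measure Z), ν (K ∪ L)ᶜ = 0 → ∀ B, ν B = ν (B ∩ (K ∪ L)) :=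
    fun ν hν B => cut_null ν _ hν B
  have gen : ∀ (μ ν : Measure Z) [IsFiniteMeasure μ] [IsFiniteMeasure ν], μ (K ∪ L)ᶜ = 0 →
      ν (K ∪ L)ᶜ = 0 → (∀ S : Finset F, μ.real (ψ ⁻¹' S) ≤ ν.real (ψ ⁻¹' (N S)) + δ) →
      ∀ A, μ A ≤ ν (Metric.cthickening (δ + 5 * η) A) + ENNReal.ofReal δ := by
    intro μ ν _ _ hμ hν h A
    have h := h (Finset.univ.filter (fun i => ∃ a ∈ A ∩ (K ∪ L), ψ a = i))
    rw [← real_le_of _ _ _ _ _ hδ.le] at h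
    rw [cut μ hμ A]
    refine (measure_mono ?_).trans (h.trans ?_)
    · intro z hz
      simp only [Set.mem_preimage, Finset.mem_coe, Finset.mem_filter, Finset.mem_univ, true_and]
      exact ⟨z, hz, rfl⟩
    · gcongr ?_ + _
      rw [cut ν hν]
      apply measure_mono
      rintro z ⟨hz, hzKL⟩
      exact fin A z hzKL hz
  intro A _
  refine ⟨gen m' n' hmKL hnKL (fun S => ?_) A, gen n' m' hnKL hmKL (fun S => ?_) A⟩
  · have := hx1 S
    rwa [sum_eq, ← hn'x] at this
  · have := hx2 S
    rwa [sum_eq, ← hn'x] at this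

lemma prokhorov_bdd {Z : Type*} [MetricSpace Z] [MeasurableSpace Z] (μ ν : Measure Z) :
    BddBelow {ε : ℝ | 0 < ε ∧ ∀ A : Set Z, IsClosed A →
    μ A ≤ ν (Metric.cthickening ε A) + ENNReal.ofReal ε ∧
    ν A ≤ μ (Metric.cthickening ε A) + ENNReal.ofReal ε} :=
  ⟨0, fun _ h => h.1.le⟩

lemma prokhorov_of_lt {Z : Type*} [MetricSpace Z] [MeasurableSpace Z] (μ ν : Measure Z)
    [IsFiniteMeasure μ] [IsFiniteMeasure ν] (δ : ℝ) (h : prokhorovDist μ ν < δ) :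
    0 < δ ∧ ∀ A : Set Z, IsClosed A →
    μ A ≤ ν (Metric.cthickening δ A) + ENNReal.ofReal δ ∧
    ν A ≤ μ (Metric.cthickening δ A) + ENNReal.ofReal δ := by
  have hne : {ε : ℝ | 0 < ε ∧ ∀ A : Set Z, IsClosed A →
      μ A ≤ ν (Metric.cthickening ε A) + ENNReal.ofReal ε ∧
      ν A ≤ μ (Metric.cthickening ε A) + ENNReal.ofReal ε}.Nonempty := by
    refine ⟨μ.real Set.univ + ν.real Set.univ + 1, by positivity, fun A _ => ⟨?_, ?_⟩⟩
    · rw [real_le_of _ _ _ _ _ (by positivity)]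
      have : μ.real A ≤ μ.real Set.univ := measureReal_mono (Set.subset_univ _)
      have : 0 ≤ ν.real Set.univ := measureReal_nonneg
      have : 0 ≤ ν.real (Metric.cthickening (μ.real Set.univ + ν.real Set.univ + 1) A) :=
        measureReal_nonneg
      linarith
    · rw [real_le_of _ _ _ _ _ (by positivity)]
      have : ν.real A ≤ ν.real Set.univ := measureReal_mono (Set.subset_univ _)
      have : 0 ≤ μ.real Set.univ := measureReal_nonneg
      have : 0 ≤ μ.real (Metric.cthickening (μ.real Set.univ + ν.real Set.univ + 1) A) :=
        measureReal_nonneg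
      linarith
  obtain ⟨ε, ⟨h0, hε⟩, hlt⟩ := exists_lt_of_csInf_lt hne h
  refine ⟨h0.trans hlt, fun A hA => ?_⟩
  have hsub := Metric.cthickening_mono hlt.le A
  have hof := ENNReal.ofReal_le_ofReal hlt.le
  exact ⟨(hε A hA).1.trans (add_le_add (measure_mono hsub) hof),
    (hε A hA).2.trans (add_le_add (measure_mono hsub) hof)⟩

lemma value_nonneg {𝒳 𝒴 : PMM} (e : GHPEmbedding 𝒳 𝒴) : 0 ≤ e.value :=
  dist_nonneg.trans (le_max_left _ _)

lemma cGHP_nonneg (𝒳 𝒴 : PMM) : 0 ≤ cGHP 𝒳 𝒴 := by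
  apply Real.sInf_nonneg
  rintro x ⟨e, _, rfl⟩
  exact value_nonneg e

lemma cGHP_le_value {𝒳 𝒴 : PMM} (e : GHPEmbedding 𝒳 𝒴) (he : e.IsIsometric) :
    cGHP 𝒳 𝒴 ≤ e.value := by
  apply csInf_le
  · refine ⟨0, ?_⟩
    rintro x ⟨e, _, rfl⟩
    exact value_nonneg e
  · exact ⟨e, he, rfl⟩

lemma exists_of_cGHP_lt {𝒳 𝒴 : PMM} {δ : ℝ} (h : cGHP 𝒳 𝒴 < δ) :
    ∃ e : GHPEmbedding 𝒳 𝒴, e.IsIsometric ∧ e.value < δ := by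
  have hne : {x : ℝ | ∃ e : GHPEmbedding 𝒳 𝒴, e.IsIsometric ∧ x = e.value}.Nonempty := by
    let e : GHPEmbedding 𝒳 𝒴 :=
      { Z := 𝒳.carrier ⊕ 𝒴.carrier
        mZ := Metric.metricSpaceSum
        f := Sum.inl
        g := Sum.inr }
    exact ⟨e.value, e, ⟨Metric.isometry_inl, Metric.isometry_inr⟩, rfl⟩
  obtain ⟨x, ⟨e, he, rfl⟩, hlt⟩ := exists_lt_of_csInf_lt hne h
  exact ⟨e, he, hlt⟩

/-- Pushforward of the measure of a compact subspace. -/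
lemma map_toPMM {𝒳 : PMM} (S T : SubPMM 𝒳) (hTS : T.set ⊆ S.set) (hT : IsCompact T.set)
    {Z : Type} [MetricSpace Z] [MeasurableSpace Z] [BorelSpace Z] (f : S.toPMM.carrier → Z)
    (hf : Isometry f) (A : Set Z) (hA : MeasurableSet A) :
    (T.toPMM.meas.map (fun x : T.toPMM.carrier => f ⟨x.1, hTS x.2⟩)) A =
      T.meas (Subtype.val '' (f ⁻¹' A : Set ↥S.set)) := by
  have hinc : Isometry (fun x : T.toPMM.carrier => (⟨x.1, hTS x.2⟩ : S.toPMM.carrier)) :=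
    fun x y => rfl
  have hiso : Isometry (fun x : T.toPMM.carrier => f ⟨x.1, hTS x.2⟩) := hf.comp hinc
  have hmeas : Measurable (fun x : T.toPMM.carrier => f ⟨x.1, hTS x.2⟩) :=
    hiso.continuous.measurable
  rw [Measure.map_apply hmeas hA]
  have hval : Isometry (fun x : T.toPMM.carrier => (x.1 : 𝒳.carrier)) := fun x y => rfl
  have hce : CompactSpace T.toPMM.carrier := isCompact_iff_compactSpace.1 hT
  have hemb : MeasurableEmbedding (fun x : T.toPMM.carrier => (x.1 : 𝒳.carrier)) :=
    hval.isClosedEmbedding.measurableEmbedding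
  have := hemb.comap_apply T.meas ((fun x : T.toPMM.carrier => f ⟨x.1, hTS x.2⟩) ⁻¹' A)
  refine Eq.trans this ?_
  rw [cut_null T.meas T.set T.supported (Subtype.val '' (f ⁻¹' A : Set ↥S.set))]
  congr 1
  ext x
  constructor
  · rintro ⟨y, hy, rfl⟩
    exact ⟨⟨⟨y.1, hTS y.2⟩, hy, rfl⟩, y.2⟩
  · rintro ⟨⟨y, hy, rfl⟩, hyT⟩
    exact ⟨⟨y.1, hyT⟩, hy, rfl⟩

lemma ballSub_set (𝒳 : PMM) {r : ℝ} (hr : 0 ≤ r) :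
    (𝒳.ballSub r).set = Metric.closedBall 𝒳.basepoint r :=
  Set.insert_eq_of_mem (Metric.mem_closedBall_self hr)

lemma ballSub_meas (𝒳 : PMM) {r : ℝ} (hr : 0 ≤ r) :
    (𝒳.ballSub r).meas = 𝒳.meas.restrict (Metric.closedBall 𝒳.basepoint r) := by
  change 𝒳.meas.restrict (insert _ _) = _
  rw [Set.insert_eq_of_mem (Metric.mem_closedBall_self hr)]

lemma ballSub_compact (𝒳 : PMM) (h : 𝒳.BoundedlyCompact) {r : ℝ} (hr : 0 ≤ r) :
    (𝒳.ballSub r).IsCompactSub := by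
  refine ⟨?_, ?_⟩
  · rw [ballSub_set 𝒳 hr]; exact h.1 _ _
  · rw [ballSub_meas 𝒳 hr, Measure.restrict_apply_univ]; exact h.2 _ _

lemma ballSub_le {𝒳 : PMM} {r s : ℝ} (h : r ≤ s) :
    𝒳.ballSub r ≤ 𝒳.ballSub s := by
  have : insert 𝒳.basepoint (Metric.closedBall 𝒳.basepoint r) ⊆
      insert 𝒳.basepoint (Metric.closedBall 𝒳.basepoint s) :=
    Set.insert_subset_insert (Metric.closedBall_subset_closedBall h)
  exact ⟨this, Measure.restrict_mono this le_rfl⟩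

lemma aFun_bdd (ε r : ℝ) (𝒳 𝒴 : PMM) :
    BddBelow {x : ℝ | ∃ Y' : SubPMM 𝒴, Y'.IsCompactSub ∧ 𝒴.ballSub (r - ε) ≤ Y' ∧
    x = cGHP ((𝒳.ballSub r).toPMM) Y'.toPMM} := by
  refine ⟨0, ?_⟩
  rintro x ⟨Y', _, _, rfl⟩
  exact cGHP_nonneg _ _

lemma aFun_le {ε r : ℝ} {𝒳 𝒴 : PMM} (Y' : SubPMM 𝒴) (h : Y'.IsCompactSub)
    (h' : 𝒴.ballSub (r - ε) ≤ Y') : aFun ε r 𝒳 𝒴 ≤ cGHP ((𝒳.ballSub r).toPMM) Y'.toPMM :=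
  csInf_le (aFun_bdd _ _ _ _) ⟨Y', h, h', rfl⟩

lemma aFun_nonempty {ε r : ℝ} {𝒳 𝒴 : PMM} (h𝒴 : 𝒴.BoundedlyCompact) (h : ε ≤ r) :
    {x : ℝ | ∃ Y' : SubPMM 𝒴, Y'.IsCompactSub ∧ 𝒴.ballSub (r - ε) ≤ Y' ∧
    x = cGHP ((𝒳.ballSub r).toPMM) Y'.toPMM}.Nonempty :=
  ⟨_, 𝒴.ballSub (r - ε), ballSub_compact 𝒴 h𝒴 (by linarith), ballSub_le le_rfl, rfl⟩

lemma exists_of_aFun_lt {ε r δ : ℝ} {𝒳 𝒴 : PMM} (h𝒴 : 𝒴.BoundedlyCompact) (h : ε ≤ r)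
    (hlt : aFun ε r 𝒳 𝒴 < δ) : ∃ Y' : SubPMM 𝒴, Y'.IsCompactSub ∧ 𝒴.ballSub (r - ε) ≤ Y' ∧
    cGHP ((𝒳.ballSub r).toPMM) Y'.toPMM < δ := by
  obtain ⟨x, ⟨Y', h1, h2, rfl⟩, h3⟩ := exists_lt_of_csInf_lt (aFun_nonempty h𝒴 h) hlt
  exact ⟨Y', h1, h2, h3⟩

lemma ball_right_cont (𝒳 : PMM) (h : 𝒳.BoundedlyCompact) (r θ : ℝ) (hθ : 0 < θ) :
    ∃ κ > 0, ∀ r' ≤ r + κ,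
      (∀ x, dist x 𝒳.basepoint ≤ r' → ∃ y, dist y 𝒳.basepoint ≤ r ∧ dist x y ≤ θ) ∧
      𝒳.meas (Metric.closedBall 𝒳.basepoint r') ≤
        𝒳.meas (Metric.closedBall 𝒳.basepoint r) + ENNReal.ofReal θ := by
  set o := 𝒳.basepoint
  let V : ℕ → Set 𝒳.carrier := fun k => Metric.closedBall o (r + 1 / ((k : ℝ) + 1))
  have hV : Antitone V := fun i j hij =>
    Metric.closedBall_subset_closedBall (by gcongr)
  have hI : ⋂ k, V k = Metric.closedBall o r := by
    ext x
    simp only [Set.mem_iInter, V, Metric.mem_closedBall]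
    constructor
    · intro hx
      have ht : Tendsto (fun k : ℕ => r + 1 / ((k : ℝ) + 1)) atTop (𝓝 (r + 0)) :=
        tendsto_const_nhds.add tendsto_one_div_add_atTop_nhds_zero_nat
      rw [add_zero] at ht
      exact ge_of_tendsto' ht hx
    · intro hx k
      have : 0 < 1 / ((k : ℝ) + 1) := by positivity
      linarith
  have h1 : ∃ k, V k ⊆ Metric.thickening θ (Metric.closedBall o r) := by
    apply exists_subset_nhds_of_isCompact' (V := V)
    · exact hV.directed_ge
    · intro i; exact h.1 _ _
    · intro i; exact Metric.isClosed_closedBall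
    · intro x hx
      rw [hI] at hx
      exact Metric.isOpen_thickening.mem_nhds (Metric.self_subset_thickening hθ _ hx)
  have h2 : ∃ k, 𝒳.meas (V k) ≤ 𝒳.meas (Metric.closedBall o r) + ENNReal.ofReal θ := by
    have ht := tendsto_measure_iInter_atTop (μ := 𝒳.meas) (s := V)
      (fun i => Metric.isClosed_closedBall.measurableSet.nullMeasurableSet) hV ⟨0, h.2 _ _⟩
    rw [hI] at ht
    have : ∀ᶠ k in atTop, (𝒳.meas ∘ V) k < 𝒳.meas (Metric.closedBall o r) + ENNReal.ofReal θ :=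
      ht.eventually (gt_mem_nhds (ENNReal.lt_add_right (h.2 _ _) (by simpa using hθ)))
    obtain ⟨k, hk⟩ := this.exists
    exact ⟨k, hk.le⟩
  obtain ⟨k1, hk1⟩ := h1
  obtain ⟨k2, hk2⟩ := h2
  refine ⟨1 / (((max k1 k2 : ℕ) : ℝ) + 1), by positivity, fun r' hr' => ?_⟩
  have hsub : Metric.closedBall o r' ⊆ V (max k1 k2) := Metric.closedBall_subset_closedBall hr'
  constructor
  · intro x hx
    have := hk1 (hV (le_max_left k1 k2) (hsub hx))
    obtain ⟨y, hy, hd⟩ := Metric.mem_thickening_iff.1 this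
    exact ⟨y, hy, hd.le⟩
  · exact (measure_mono (hsub.trans (hV (le_max_right k1 k2)))).trans hk2

lemma key (𝒳 𝒴 : PMM) (h𝒳 : 𝒳.BoundedlyCompact) {s t r r' δ θ η : ℝ}
    (Y' : SubPMM 𝒴) (hY'c : Y'.IsCompactSub) (ht : 0 ≤ t) (hY' : 𝒴.ballSub t ≤ Y')
    (hlt : cGHP (𝒳.ballSub s).toPMM Y'.toPMM < δ) (hr : 0 ≤ r) (hrr' : r ≤ r') (hr's : r' ≤ s)
    (htr : t + 2 * δ ≤ r') (hθ : 0 ≤ θ) (hη : 0 < η)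
    (hθ1 : ∀ x, dist x 𝒳.basepoint ≤ r' → ∃ y, dist y 𝒳.basepoint ≤ r ∧ dist x y ≤ θ)
    (hθ2 : 𝒳.meas (Metric.closedBall 𝒳.basepoint r') ≤
        𝒳.meas (Metric.closedBall 𝒳.basepoint r) + ENNReal.ofReal θ) :
    ∃ Y'' : SubPMM 𝒴, Y''.IsCompactSub ∧ 𝒴.ballSub t ≤ Y'' ∧
      cGHP (𝒳.ballSub r).toPMM Y''.toPMM ≤ δ + θ + 5 * η := by
  have hs : 0 ≤ s := by linarith
  set S := 𝒳.ballSub s with hS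
  set T := 𝒳.ballSub r with hT
  obtain ⟨e, ⟨hf, hg⟩, hval⟩ := exists_of_cGHP_lt hlt
  obtain ⟨Z, mZ, f, g⟩ := e
  let _ : MeasurableSpace Z := borel Z
  have hBor : BorelSpace Z := ⟨rfl⟩
  simp only [GHPEmbedding.value, max_lt_iff] at hval hf hg
  obtain ⟨hroot, hHaus, hProk⟩ := hval
  have hSc : S.IsCompactSub := ballSub_compact 𝒳 h𝒳 hs
  have hTc : T.IsCompactSub := ballSub_compact 𝒳 h𝒳 hr
  have hTS : T.set ⊆ S.set := (ballSub_le (hrr'.trans hr's)).1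
  have hSset : S.set = Metric.closedBall 𝒳.basepoint s := ballSub_set 𝒳 hs
  have hTset : T.set = Metric.closedBall 𝒳.basepoint r := ballSub_set 𝒳 hr
  have hSmeas : S.meas = 𝒳.meas.restrict (Metric.closedBall 𝒳.basepoint s) := ballSub_meas 𝒳 hs
  have hTmeas : T.meas = 𝒳.meas.restrict (Metric.closedBall 𝒳.basepoint r) := ballSub_meas 𝒳 hr
  have iS : CompactSpace S.toPMM.carrier := isCompact_iff_compactSpace.1 hSc.1
  have iY : CompactSpace Y'.toPMM.carrier := isCompact_iff_compactSpace.1 hY'c.1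
  set m : Measure Z := S.toPMM.meas.map f with hm
  set n : Measure Z := Y'.toPMM.meas.map g with hn
  have hmA : ∀ A, MeasurableSet A → m A = S.meas (Subtype.val '' (f ⁻¹' A : Set ↥S.set)) :=
    fun A hA => map_toPMM S S le_rfl hSc.1 f hf A hA
  have hnA : ∀ A, MeasurableSet A → n A = Y'.meas (Subtype.val '' (g ⁻¹' A : Set ↥Y'.set)) :=
    fun A hA => map_toPMM Y' Y' le_rfl hY'c.1 g hg A hA
  have fm : IsFiniteMeasure m := ⟨by
    rw [hmA _ MeasurableSet.univ]
    exact (measure_mono (Set.subset_univ _)).trans_lt (lt_top_iff_ne_top.2 hSc.2)⟩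
  have fn : IsFiniteMeasure n := ⟨by
    rw [hnA _ MeasurableSet.univ]
    exact (measure_mono (Set.subset_univ _)).trans_lt (lt_top_iff_ne_top.2 hY'c.2)⟩
  obtain ⟨hδ, hP⟩ := prokhorov_of_lt m n δ hProk
  have gemb : MeasurableEmbedding g := hg.isClosedEmbedding.measurableEmbedding
  set K := Set.range f with hK
  set L := Set.range g with hL
  set K' : Set Z := f '' {x | dist x.1 𝒳.basepoint ≤ r'} with hK'
  set L₁ : Set Z := g '' {y | dist y.1 𝒴.basepoint ≤ t} with hL₁
  have hKc : IsCompact K := isCompact_range hf.continuous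
  have hLc : IsCompact L := isCompact_range hg.continuous
  have cvX : Continuous (fun x : S.toPMM.carrier => dist x.1 𝒳.basepoint) :=
    continuous_subtype_val.dist continuous_const
  have cvY : Continuous (fun x : Y'.toPMM.carrier => dist x.1 𝒴.basepoint) :=
    continuous_subtype_val.dist continuous_const
  have hK'c : IsCompact K' :=
    (isClosed_le cvX continuous_const).isCompact.image hf.continuous
  have hL₁c : IsCompact L₁ :=
    (isClosed_le cvY continuous_const).isCompact.image hg.continuous
  have hKne : K.Nonempty := ⟨f S.toPMM.basepoint, Set.mem_range_self _⟩
  have hLne : L.Nonempty := ⟨g Y'.toPMM.basepoint, Set.mem_range_self _⟩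
  have hK'K : K' ⊆ K := Set.image_subset_range _ _
  have hL₁L : L₁ ⊆ L := Set.image_subset_range _ _
  have hmK : m Kᶜ = 0 := by
    rw [hmA _ hKc.isClosed.measurableSet.compl]
    refine measure_mono_null (t := ∅) ?_ measure_empty
    rintro _ ⟨x, hx, rfl⟩
    exact hx ⟨x, rfl⟩
  have hnL : n Lᶜ = 0 := by
    rw [hnA _ hLc.isClosed.measurableSet.compl]
    refine measure_mono_null (t := ∅) ?_ measure_empty
    rintro _ ⟨x, hx, rfl⟩
    exact hx ⟨x, rfl⟩
  have htop : Metric.hausdorffEDist K L ≠ ⊤ :=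
    Metric.hausdorffEDist_ne_top_of_nonempty_of_bounded hKne hLne hKc.isBounded hLc.isBounded
  have hLK : ∀ z ∈ K, z ∈ Metric.cthickening δ L₁ → z ∈ K' := by
    rintro _ ⟨x, rfl⟩ hz
    rw [hL₁c.cthickening_eq_biUnion_closedBall hδ.le] at hz
    simp only [Set.mem_iUnion, Metric.mem_closedBall, exists_prop] at hz
    obtain ⟨_, ⟨y, hy, rfl⟩, hd⟩ := hz
    refine ⟨x, ?_, rfl⟩
    have a1 := dist_triangle4 (f x) (g y) (g Y'.toPMM.basepoint) (f S.toPMM.basepoint)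
    rw [hf.dist_eq, hg.dist_eq, dist_comm (g Y'.toPMM.basepoint)] at a1
    have a2 : dist x S.toPMM.basepoint = dist x.1 𝒳.basepoint := rfl
    have a3 : dist y Y'.toPMM.basepoint = dist y.1 𝒴.basepoint := rfl
    change dist y.1 𝒴.basepoint ≤ t at hy
    change dist x.1 𝒳.basepoint ≤ r'
    linarith
  have hLK' : L₁ ⊆ Metric.cthickening δ K' := by
    intro z hz
    obtain ⟨x, hx, hd⟩ := Metric.exists_dist_lt_of_hausdorffDist_lt' (hL₁L hz) hHaus htop
    have : x ∈ K' := hLK x hx (Metric.mem_cthickening_of_dist_le x z _ _ hz (hd.le))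
    exact Metric.mem_cthickening_of_dist_le z x _ _ this (by rw [dist_comm]; exact hd.le)
  obtain ⟨n', hn'n, hn'1, hn'0, hn'P⟩ := core_Z m n K L K' L₁ hKc hLc hKne
    hL₁c.isClosed hK'K hL₁L hmK hnL δ hδ hP hLK hLK' η hη
  have vemb : MeasurableEmbedding (fun y : Y'.toPMM.carrier => (y.1 : 𝒴.carrier)) :=
    (Isometry.isClosedEmbedding (f := fun y : Y'.toPMM.carrier => (y.1 : 𝒴.carrier))
      (fun x y => rfl)).measurableEmbedding
  set ν : Measure 𝒴.carrier :=
    (n'.comap g).map (fun y : Y'.toPMM.carrier => (y.1 : 𝒴.carrier)) with hν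
  have hνB : ∀ B, MeasurableSet B →
      ν B = n' (g '' ((fun y : Y'.toPMM.carrier => (y.1 : 𝒴.carrier)) ⁻¹' B)) := by
    intro B hB
    rw [hν, Measure.map_apply vemb.measurable hB, gemb.comap_apply]
  have hgB : ∀ B : Set 𝒴.carrier, MeasurableSet B → MeasurableSet
      (g '' ((fun y : Y'.toPMM.carrier => (y.1 : 𝒴.carrier)) ⁻¹' B)) := fun B hB =>
    gemb.measurableSet_image.2 (vemb.measurable hB)
  have hnB : ∀ B, MeasurableSet B →
      n (g '' ((fun y : Y'.toPMM.carrier => (y.1 : 𝒴.carrier)) ⁻¹' B)) = Y'.meas B := by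
    intro B hB
    rw [hnA _ (hgB B hB), cut_null Y'.meas Y'.set Y'.supported B]
    congr 1
    ext y
    constructor
    · rintro ⟨y, ⟨y2, hy, hyy⟩, rfl⟩
      rw [hg.injective hyy] at hy
      exact ⟨hy, y.2⟩
    · rintro ⟨hy, hy'⟩; exact ⟨⟨y, hy'⟩, ⟨⟨y, hy'⟩, hy, rfl⟩, rfl⟩
  have hνle : ν ≤ Y'.meas := by
    rw [Measure.le_iff]
    intro B hB
    rw [hνB B hB, ← hnB B hB]
    exact hn'n _
  set W : Set 𝒴.carrier := (fun y : Y'.toPMM.carrier => (y.1 : 𝒴.carrier)) ''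
    (g ⁻¹' (Metric.cthickening δ K')) with hW
  have hWc : IsCompact W :=
    (Metric.isClosed_cthickening.preimage hg.continuous).isCompact.image continuous_subtype_val
  have hWY : W ⊆ Y'.set := by rintro _ ⟨y, _, rfl⟩; exact y.2
  have htset : (𝒴.ballSub t).set = Metric.closedBall 𝒴.basepoint t := ballSub_set 𝒴 ht
  have htW : Metric.closedBall 𝒴.basepoint t ⊆ W := by
    intro y hy
    have hyY : y ∈ Y'.set := hY'.1 (htset ▸ hy)
    exact ⟨⟨y, hyY⟩, hLK' ⟨⟨y, hyY⟩, hy, rfl⟩, rfl⟩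
  let Y'' : SubPMM 𝒴 :=
    { set := W
      root_mem := htW (Metric.mem_closedBall_self ht)
      meas := ν
      meas_le := hνle.trans Y'.meas_le
      supported := by
        rw [hνB _ hWc.isClosed.measurableSet.compl]
        apply measure_mono_null _ hn'0
        rintro _ ⟨y, hy, rfl⟩ ⟨_, hz⟩
        exact hy ⟨y, hz, rfl⟩ }
  have hY''c : Y''.IsCompactSub :=
    ⟨hWc, ne_top_of_le_ne_top hY'c.2 (hνle Set.univ)⟩
  refine ⟨Y'', hY''c, ⟨?_, ?_⟩, ?_⟩
  · rw [htset]; exact htW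
  · rw [Measure.le_iff]
    intro B hB
    change _ ≤ ν B
    have hBt : MeasurableSet (B ∩ Metric.closedBall 𝒴.basepoint t) :=
      hB.inter Metric.isClosed_closedBall.measurableSet
    calc (𝒴.ballSub t).meas B = (𝒴.ballSub t).meas (B ∩ Metric.closedBall 𝒴.basepoint t) := by
          apply cut_null
          have := (𝒴.ballSub t).supported
          rwa [htset] at this
      _ ≤ Y'.meas (B ∩ Metric.closedBall 𝒴.basepoint t) := hY'.2 _
      _ = n (g '' ((fun y : Y'.toPMM.carrier => (y.1 : 𝒴.carrier)) ⁻¹'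
            (B ∩ Metric.closedBall 𝒴.basepoint t))) := (hnB _ hBt).symm
      _ ≤ n.restrict L₁ (g '' ((fun y : Y'.toPMM.carrier => (y.1 : 𝒴.carrier)) ⁻¹' B)) := by
          rw [Measure.restrict_apply (hgB B hB)]
          apply measure_mono
          rintro _ ⟨y, hy, rfl⟩
          exact ⟨⟨y, hy.1, rfl⟩, ⟨y, hy.2, rfl⟩⟩
      _ ≤ n' (g '' ((fun y : Y'.toPMM.carrier => (y.1 : 𝒴.carrier)) ⁻¹' B)) := hn'1 _
      _ = ν B := (hνB B hB).symm
  let e' : GHPEmbedding T.toPMM Y''.toPMM :=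
    { Z := Z
      mZ := mZ
      f := fun x => f ⟨x.1, hTS x.2⟩
      g := fun y => g ⟨y.1, hWY y.2⟩ }
  have he' : e'.IsIsometric :=
    ⟨hf.comp (fun x y => rfl : Isometry (fun x : T.toPMM.carrier =>
        (⟨x.1, hTS x.2⟩ : S.toPMM.carrier))),
      hg.comp (fun x y => rfl : Isometry (fun y : Y''.toPMM.carrier =>
        (⟨y.1, hWY y.2⟩ : Y'.toPMM.carrier)))⟩
  refine (cGHP_le_value e' he').trans ?_
  have hmapX : ∀ A, MeasurableSet A →
      (T.toPMM.meas.map e'.f) A = 𝒳.meas (Subtype.val '' (f ⁻¹' A : Set ↥S.set) ∩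
        Metric.closedBall 𝒳.basepoint r) := by
    intro A hA
    refine (map_toPMM S T hTS hTc.1 f hf A hA).trans ?_
    rw [hTmeas, Measure.restrict_apply' Metric.isClosed_closedBall.measurableSet]
  have hmK' : ∀ A, MeasurableSet A →
      (m.restrict K') A = 𝒳.meas (Subtype.val '' (f ⁻¹' A : Set ↥S.set) ∩
        Metric.closedBall 𝒳.basepoint r') := by
    intro A hA
    rw [Measure.restrict_apply hA, hmA _ (hA.inter hK'c.isClosed.measurableSet), hSmeas,
      Measure.restrict_apply' Metric.isClosed_closedBall.measurableSet]
    congr 1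
    ext x
    constructor
    · rintro ⟨⟨x, ⟨hx, ⟨y, hy, hyx⟩⟩, rfl⟩, _⟩
      rw [hf.injective hyx] at hy
      exact ⟨⟨x, hx, rfl⟩, hy⟩
    · rintro ⟨⟨x, hx, rfl⟩, hxr⟩
      exact ⟨⟨x, ⟨hx, ⟨x, hxr, rfl⟩⟩, rfl⟩, Metric.closedBall_subset_closedBall hr's hxr⟩
  have hmapY : ∀ A, MeasurableSet A → (Y''.toPMM.meas.map e'.g) A = n' A := by
    intro A hA
    refine (map_toPMM Y' Y'' hWY hWc g hg A hA).trans ?_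
    change ν _ = _
    have hV : MeasurableSet ((fun y : Y'.toPMM.carrier => (y.1 : 𝒴.carrier)) '' (g ⁻¹' A)) :=
      vemb.measurableSet_image.2 (gemb.measurable hA)
    refine (hνB _ hV).trans ?_
    rw [Set.preimage_image_eq _ vemb.injective, Set.image_preimage_eq_inter_range,
      ← cut_null n' L _ A]
    exact measure_mono_null (Set.compl_subset_compl.2 Set.inter_subset_left) hn'0
  have hpos : 0 < δ + θ + 5 * η := by linarith
  refine max_le ?_ (max_le ?_ ?_)
  · change dist (f S.toPMM.basepoint) (g Y'.toPMM.basepoint) ≤ _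
    linarith
  · apply Metric.hausdorffDist_le_of_mem_dist hpos.le
    · rintro _ ⟨x, rfl⟩
      have hxT : dist x.1 𝒳.basepoint ≤ r :=
        hTset.subset x.2
      have hx : f ⟨x.1, hTS x.2⟩ ∈ K := Set.mem_range_self _
      obtain ⟨_, ⟨y, rfl⟩, hd⟩ := Metric.exists_dist_lt_of_hausdorffDist_lt hx hHaus htop
      have hxK' : f ⟨x.1, hTS x.2⟩ ∈ K' := ⟨_, hxT.trans hrr', rfl⟩
      have hy : g y ∈ Metric.cthickening δ K' :=
        Metric.mem_cthickening_of_dist_le _ _ _ _ hxK' (by rw [dist_comm]; exact hd.le)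
      refine ⟨g y, ⟨⟨y.1, ⟨y, hy, rfl⟩⟩, rfl⟩, ?_⟩
      change dist (f ⟨x.1, hTS x.2⟩) (g y) ≤ _
      linarith
    · rintro _ ⟨⟨_, ⟨y, hy, rfl⟩⟩, rfl⟩
      have hy' : g y ∈ Metric.cthickening δ K' := hy
      rw [hK'c.cthickening_eq_biUnion_closedBall hδ.le] at hy'
      simp only [Set.mem_iUnion, Metric.mem_closedBall, exists_prop] at hy'
      obtain ⟨_, ⟨x, hx, rfl⟩, hd⟩ := hy'
      obtain ⟨x2, hx2, hd2⟩ := hθ1 x.1 hx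
      have hx2T : x2 ∈ T.set := by rw [hTset]; exact hx2
      refine ⟨f ⟨x2, hTS hx2T⟩, ⟨⟨x2, hx2T⟩, rfl⟩, ?_⟩
      change dist (g y) (f ⟨x2, hTS hx2T⟩) ≤ _
      have a1 := dist_triangle (g y) (f x) (f ⟨x2, hTS hx2T⟩)
      have a2 : dist (f x) (f ⟨x2, hTS hx2T⟩) = dist x.1 x2 := hf.dist_eq _ _
      linarith
  · refine csInf_le (prokhorov_bdd _ _) ⟨hpos, fun A hA => ?_⟩
    have hct : MeasurableSet (Metric.cthickening (δ + θ + 5 * η) A) :=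
      Metric.isClosed_cthickening.measurableSet
    have hct2 : MeasurableSet (Metric.cthickening (δ + 5 * η) A) :=
      Metric.isClosed_cthickening.measurableSet
    have hsub : Metric.cthickening (δ + 5 * η) A ⊆ Metric.cthickening (δ + θ + 5 * η) A :=
      Metric.cthickening_mono (by linarith) A
    have hof : ENNReal.ofReal δ ≤ ENNReal.ofReal (δ + θ + 5 * η) :=
      ENNReal.ofReal_le_ofReal (by linarith)
    obtain ⟨p1, p2⟩ := hn'P A hA
    constructor
    · refine Eq.trans_le (hmapX A hA.measurableSet) ?_
      refine le_trans ?_ (add_le_add_left (hmapY _ hct).ge _)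
      calc _ ≤ 𝒳.meas (Subtype.val '' (f ⁻¹' A : Set ↥S.set) ∩
            Metric.closedBall 𝒳.basepoint r') :=
            measure_mono (Set.inter_subset_inter_right _ (Metric.closedBall_subset_closedBall hrr'))
        _ = (m.restrict K') A := (hmK' A hA.measurableSet).symm
        _ ≤ _ := p1.trans (add_le_add (measure_mono hsub) hof)
    · refine Eq.trans_le (hmapY A hA.measurableSet) ?_
      refine le_trans ?_ (add_le_add_left (hmapX _ hct).ge _)
      have hsum : ENNReal.ofReal θ + ENNReal.ofReal δ ≤ ENNReal.ofReal (δ + θ + 5 * η) := by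
        rw [← ENNReal.ofReal_add hθ hδ.le]
        exact ENNReal.ofReal_le_ofReal (by linarith)
      refine p2.trans ?_
      rw [hmK' _ hct2]
      set U : Set 𝒳.carrier :=
        Subtype.val '' (f ⁻¹' (Metric.cthickening (δ + 5 * η) A) : Set ↥S.set) with hU
      have hann : 𝒳.meas (Metric.closedBall 𝒳.basepoint r' \ Metric.closedBall 𝒳.basepoint r) ≤
          ENNReal.ofReal θ := by
        rw [measure_sdiff (Metric.closedBall_subset_closedBall hrr')
          Metric.isClosed_closedBall.measurableSet.nullMeasurableSet (h𝒳.2 _ _)]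
        rw [tsub_le_iff_left]
        exact hθ2
      calc 𝒳.meas (U ∩ Metric.closedBall 𝒳.basepoint r') + ENNReal.ofReal δ
          ≤ 𝒳.meas (U ∩ Metric.closedBall 𝒳.basepoint r) + ENNReal.ofReal θ
              + ENNReal.ofReal δ := by
            gcongr
            refine le_trans (measure_mono (t := (U ∩ Metric.closedBall 𝒳.basepoint r) ∪
              (Metric.closedBall 𝒳.basepoint r' \ Metric.closedBall 𝒳.basepoint r)) ?_)
              ((measure_union_le _ _).trans (add_le_add le_rfl hann))
            rintro x ⟨hx, hx'⟩
            by_cases h : x ∈ Metric.closedBall 𝒳.basepoint r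
            · exact Or.inl ⟨hx, h⟩
            · exact Or.inr ⟨hx', h⟩
        _ ≤ _ := by
            rw [add_assoc]
            refine add_le_add (measure_mono ?_) hsum
            apply Set.inter_subset_inter_left
            exact Set.image_mono (Set.preimage_mono hsub)

/-- For boundedly compact pmm spaces `𝒳`, `𝒴`: `a(ε, r; 𝒳, 𝒴)` is non-increasing in `ε`
(for fixed `r`); moreover if `a(ε, r₀; 𝒳, 𝒴) ≤ ε/2` then `r ↦ a(ε, r; 𝒳, 𝒴)` is
non-decreasing on `[ε, r₀]`. -/
theorem aFun_monotone (𝒳 𝒴 : PMM) (h𝒳 : 𝒳.BoundedlyCompact) (h𝒴 : 𝒴.BoundedlyCompact) :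
    (∀ r ε₁ ε₂ : ℝ, 0 ≤ ε₁ → ε₁ ≤ ε₂ → ε₂ ≤ r → aFun ε₂ r 𝒳 𝒴 ≤ aFun ε₁ r 𝒳 𝒴) ∧
    (∀ ε r₀ : ℝ, 0 ≤ ε → ε ≤ r₀ → aFun ε r₀ 𝒳 𝒴 ≤ ε / 2 →
      ∀ r s : ℝ, ε ≤ r → r ≤ s → s ≤ r₀ → aFun ε r 𝒳 𝒴 ≤ aFun ε s 𝒳 𝒴) := by
  constructor
  · intro r ε₁ ε₂ h0 h12 h2r
    refine csInf_le_csInf (aFun_bdd _ _ _ _) (aFun_nonempty h𝒴 (h12.trans h2r)) ?_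
    rintro x ⟨Y', h1, h2, rfl⟩
    have hb : 𝒴.ballSub (r - ε₂) ≤ 𝒴.ballSub (r - ε₁) := ballSub_le (by linarith)
    exact ⟨Y', h1, ⟨hb.1.trans h2.1, hb.2.trans h2.2⟩, rfl⟩
  · intro ε r₀ h0 hεr₀ ha r s hεr hrs hsr₀
    rcases hrs.eq_or_lt with rfl | hrs'
    · exact le_rfl
    rcases lt_or_ge (aFun ε s 𝒳 𝒴) (ε / 2) with hα | hα
    · apply le_of_forall_pos_le_add
      intro ζ hζ
      set δ := min (aFun ε s 𝒳 𝒴 + ζ / 2) (ε / 2) with hδ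
      have hδ1 : aFun ε s 𝒳 𝒴 < δ := lt_min (by linarith) hα
      have hδ2 : δ ≤ aFun ε s 𝒳 𝒴 + ζ / 2 := min_le_left _ _
      have hδ3 : δ ≤ ε / 2 := min_le_right _ _
      obtain ⟨Y', h1, h2, h3⟩ := exists_of_aFun_lt h𝒴 (hεr.trans hrs) hδ1
      have hb : 𝒴.ballSub (r - ε) ≤ 𝒴.ballSub (s - ε) := ballSub_le (by linarith)
      obtain ⟨Y'', k1, k2, k3⟩ := key 𝒳 𝒴 h𝒳 (s := s) (t := r - ε) (r := r) (r' := r) (δ := δ)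
        (θ := 0) (η := ζ / 10) Y' h1 (by linarith) ⟨hb.1.trans h2.1, hb.2.trans h2.2⟩ h3
        (by linarith) le_rfl hrs (by linarith) le_rfl (by linarith)
        (fun x hx => ⟨x, hx, by simp⟩) (by simp)
      exact (aFun_le Y'' k1 k2).trans (by linarith)
    · refine le_trans ?_ hα
      apply le_of_forall_pos_le_add
      intro ζ hζ
      obtain ⟨κ, hκ, hball⟩ := ball_right_cont 𝒳 h𝒳 r (ζ / 4) (by linarith)
      set c := min (min (κ / 2) ((s - r) / 2)) (ζ / 4) with hc
      have hc0 : 0 < c := lt_min (lt_min (by linarith) (by linarith)) (by linarith)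
      have hc1 : c ≤ κ / 2 := (min_le_left _ _).trans (min_le_left _ _)
      have hc2 : c ≤ (s - r) / 2 := (min_le_left _ _).trans (min_le_right _ _)
      have hc3 : c ≤ ζ / 4 := min_le_right _ _
      obtain ⟨hb1, hb2⟩ := hball (r + 2 * c) (by linarith)
      obtain ⟨Y', h1, h2, h3⟩ := exists_of_aFun_lt h𝒴 hεr₀
        (show aFun ε r₀ 𝒳 𝒴 < ε / 2 + c by linarith)
      have hb : 𝒴.ballSub (r - ε) ≤ 𝒴.ballSub (r₀ - ε) := ballSub_le (by linarith)
      obtain ⟨Y'', k1, k2, k3⟩ := key 𝒳 𝒴 h𝒳 (s := r₀) (t := r - ε) (r := r) (r' := r + 2 * c)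
        (δ := ε / 2 + c) (θ := ζ / 4) (η := ζ / 10) Y' h1 (by linarith)
        ⟨hb.1.trans h2.1, hb.2.trans h2.2⟩ h3
        (by linarith) (by linarith) (by linarith) (by linarith) (by linarith) (by linarith) hb1 hb2
      exact (aFun_le Y'' k1 k2).trans (by linarith)

end
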